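/- Let A be a K-subalgebra of K[x] of codimension n (i.e. the quotient K[x]/A has K-dimension n). Then Sp(A) is a finite set with at most 2n elements. Moreover, Sp(A) has exactly 2n elements if and only if there exist 2n pairwise distinct elements α_1, β_1, ..., α_n, β_n ∈ K such that A = {f ∈ K[x] : f(α_i) = f(β_i) for i = 1, ..., n}. -/

import Mathlib

open Polynomial

/-- The spectrum of a subalgebra `A` of `K[x]`. -/
def subalgebraSpectrum {K : Type*} [Field K] (A : Subalgebra K (Polynomial K)) : Set K :=
  {α | (∀ f ∈ A, (Polynomial.derivative f).eval α = 0) ∨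
    ∃ β : K, β ≠ α ∧ ∀ f ∈ A, f.eval α = f.eval β}

namespace SubalgebraSpectrum

/-- Differences of evaluations at points of `N` and at points outside `N`, together with
evaluations of the derivative at distinct points, are linearly independent functionals. -/
theorem linearIndependent_eval_sub_eval_derivative {K : Type*} [Field K] {N D : Set K} {r : K → K}
    (hr : ∀ α ∈ N, r α ∉ N) :
    LinearIndependent K (Sum.elim (fun α : N => leval (α : K) - leval (r α))
      (fun δ : D => leval (δ : K) ∘ₗ derivative) : N ⊕ D → Module.Dual K K[X]) := by
  classical
  rw [linearIndependent_iff']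
  intro s g hg
  let point : N ⊕ D → K := Sum.elim (fun α => α) (fun δ => δ)
  let T : Finset K := s.image point ∪ s.image (r ∘ point)
  have hT : ∀ i ∈ s, point i ∈ T ∧ r (point i) ∈ T := fun i hi =>
    ⟨Finset.mem_union_left _ (Finset.mem_image_of_mem _ hi),
      Finset.mem_union_right _ (Finset.mem_image_of_mem (r ∘ point) hi)⟩
  let q : K → K[X] := fun γ => ∏ β ∈ T.erase γ, (X - C β)
  have hq0 : ∀ γ, ∀ β ∈ T, β ≠ γ → (q γ).eval β = 0 := by
    intro γ β hβ hne
    simp only [q, eval_prod]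
    exact Finset.prod_eq_zero (Finset.mem_erase.2 ⟨hne, hβ⟩) (by simp)
  have hq1 : ∀ γ, (q γ).eval γ ≠ 0 := by
    intro γ
    simp only [q, eval_prod, Finset.prod_ne_zero_iff]
    intro β hβ
    simpa [sub_eq_zero] using (Finset.ne_of_mem_erase hβ).symm
  have hsum := fun p : K[X] => LinearMap.congr_fun hg p
  simp only [LinearMap.sum_apply, LinearMap.smul_apply, LinearMap.zero_apply, smul_eq_mul] at hsum
  have hD : ∀ δ : D, Sum.inr δ ∈ s → g (Sum.inr δ) = 0 := by
    intro δ hδ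
    have hp : ∀ β ∈ T, ((X - C (δ : K)) * q δ ^ 2).eval β = 0 := by
      intro β hβ
      by_cases h : β = δ
      · simp [h]
      · simp [hq0 δ β hβ h]
    have h := hsum ((X - C (δ : K)) * q δ ^ 2)
    rw [Finset.sum_eq_single_of_mem _ hδ] at h
    · simpa [hq1, leval_apply] using h
    · rintro (α | ε) hi hne
      · have h1 := hp _ (hT _ hi).1
        have h2 := hp _ (hT _ hi).2
        simp only [point, Sum.elim_inl] at h1 h2
        simp only [Sum.elim_inl, LinearMap.sub_apply, leval_apply, h1, h2, sub_self, mul_zero]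
      · have h1 : (q δ).eval (ε : K) = 0 := hq0 δ ε (hT _ hi).1 fun h =>
          hne (congrArg Sum.inr (Subtype.ext h))
        simp [leval_apply, derivative_pow, h1]
  rintro (α | δ) hi
  · have h := hsum (q α)
    rw [Finset.sum_eq_single_of_mem _ hi] at h
    · have h1 : (q α).eval (r α) = 0 :=
        hq0 α _ (hT _ hi).2 fun h => hr α α.2 (h.symm ▸ α.2)
      simpa [leval_apply, h1, hq1] using h
    · rintro (β | δ) hj hne
      · have h1 : (q α).eval (β : K) = 0 := hq0 α β (hT _ hj).1 fun h =>
          hne (congrArg Sum.inl (Subtype.ext h))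
        have h2 : (q α).eval (r β) = 0 :=
          hq0 α _ (hT _ hj).2 fun h => hr β β.2 (h.symm ▸ α.2)
        simp [leval_apply, h1, h2]
      · simp [hD δ hj]
  · exact hD δ hi

variable {K : Type*} [Field K] (A : Subalgebra K K[X])

/-- Two points are related when no element of `A` separates them. -/
def evalSetoid : Setoid K where
  r α β := ∀ f ∈ A, f.eval α = f.eval β
  iseqv := ⟨fun _ _ _ => rfl, fun h f hf => (h f hf).symm,
    fun h h' f hf => (h f hf).trans (h' f hf)⟩

/-- A chosen representative of the points not separated from `α` by `A`. -/
noncomputable def rep (α : K) : K := (Quotient.mk (evalSetoid A) α).out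

theorem eval_rep (α : K) {f : K[X]} (hf : f ∈ A) : f.eval (rep A α) = f.eval α :=
  Quotient.exact (Quotient.out_eq (Quotient.mk (evalSetoid A) α)) f hf

theorem rep_eq_rep {α β : K} (h : ∀ f ∈ A, f.eval α = f.eval β) : rep A α = rep A β :=
  congrArg Quotient.out (Quotient.sound (s := evalSetoid A) h)

theorem rep_rep (α : K) : rep A (rep A α) = rep A α :=
  rep_eq_rep A fun _ hf => eval_rep A α hf

/-- The points that differ from their representative. -/
def nonRep : Set K := {α | rep A α ≠ α}

/-- The points at which all derivatives of elements of `A` vanish. -/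
def critical : Set K := {α | ∀ f ∈ A, (derivative f).eval α = 0}

theorem rep_notMem_nonRep (α : K) : rep A α ∉ nonRep A := fun h => h (rep_rep A α)

theorem spectrum_subset :
    subalgebraSpectrum A ⊆ nonRep A ∪ rep A '' nonRep A ∪ critical A := by
  rintro α (h | ⟨β, hne, h⟩)
  · exact Or.inr h
  · by_cases hα : rep A α = α
    · have hβ : rep A β = α := (rep_eq_rep A h).symm.trans hα
      exact Or.inl (Or.inr ⟨β, fun h' => hne (h'.symm.trans hβ), hβ⟩)
    · exact Or.inl (Or.inl hα)

/-- The functionals vanishing on `A` attached to non-representatives and critical points. -/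
noncomputable def functional (i : nonRep A ⊕ critical A) :
    Module.Dual K (K[X] ⧸ Subalgebra.toSubmodule A) :=
  (Subalgebra.toSubmodule A).liftQ
    (Sum.elim (fun α : nonRep A => leval (α : K) - leval (rep A α))
      (fun δ : critical A => leval (δ : K) ∘ₗ derivative) i) (by
    intro f hf
    rcases i with α | δ
    · simp [leval_apply, eval_rep A α hf]
    · exact δ.2 f hf)

theorem linearIndependent_functional : LinearIndependent K (functional A) := by
  refine LinearIndependent.of_comp (Subalgebra.toSubmodule A).mkQ.dualMap ?_
  convert linearIndependent_eval_sub_eval_derivative (N := nonRep A) (D := critical A)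
    fun α _ => rep_notMem_nonRep A α using 1
  exact funext fun i => LinearMap.ext fun f => rfl

variable [FiniteDimensional K (K[X] ⧸ Subalgebra.toSubmodule A)]

theorem finite_nonRep_sum_critical : Finite (nonRep A ⊕ critical A) :=
  (linearIndependent_functional A).finite

theorem finite_nonRep : (nonRep A).Finite :=
  have := finite_nonRep_sum_critical A
  Finite.of_injective _ (Sum.inl_injective (α := nonRep A) (β := critical A))

theorem finite_critical : (critical A).Finite :=
  have := finite_nonRep_sum_critical A
  Finite.of_injective _ (Sum.inr_injective (α := nonRep A) (β := critical A))

theorem ncard_nonRep_add_ncard_critical_le :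
    (nonRep A).ncard + (critical A).ncard ≤
      Module.finrank K (K[X] ⧸ Subalgebra.toSubmodule A) := by
  have := (finite_nonRep A).to_subtype
  have := (finite_critical A).to_subtype
  have := Fintype.ofFinite (nonRep A ⊕ critical A)
  have h := (linearIndependent_functional A).fintype_card_le_finrank
  rwa [Subspace.dual_finrank_eq, Fintype.card_eq_nat_card, Nat.card_sum] at h

theorem finite_spectrum : (subalgebraSpectrum A).Finite :=
  (((finite_nonRep A).union ((finite_nonRep A).image _)).union (finite_critical A)).subset
    (spectrum_subset A)

theorem ncard_spectrum_le_add :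
    (subalgebraSpectrum A).ncard ≤
      (nonRep A).ncard + (rep A '' nonRep A).ncard + (critical A).ncard :=
  (Set.ncard_le_ncard (spectrum_subset A)
    (((finite_nonRep A).union ((finite_nonRep A).image _)).union (finite_critical A))).trans <|
    (Set.ncard_union_le _ _).trans <| Nat.add_le_add_right (Set.ncard_union_le _ _) _

theorem ncard_spectrum_le :
    (subalgebraSpectrum A).ncard ≤
      2 * Module.finrank K (K[X] ⧸ Subalgebra.toSubmodule A) := by
  have h1 := ncard_nonRep_add_ncard_critical_le A
  have h2 := ncard_spectrum_le_add A
  have h3 := Set.ncard_image_le (f := rep A) (finite_nonRep A)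
  omega

/-- If there are as many non-representatives as the codimension of `A`, then `A` is cut out by
identifying each of them with its representative. -/
theorem mem_of_forall_eval_eq_eval_rep
    (hN : (nonRep A).ncard = Module.finrank K (K[X] ⧸ Subalgebra.toSubmodule A))
    {f : K[X]} (hf : ∀ α ∈ nonRep A, f.eval α = f.eval (rep A α)) : f ∈ A := by
  have := (finite_nonRep A).fintype
  have hli : LinearIndependent K (functional A ∘ Sum.inl) :=
    (linearIndependent_functional A).comp Sum.inl Sum.inl_injective
  have hspan := hli.span_eq_top_of_card_eq_finrank' (by
    rw [Subspace.dual_finrank_eq, ← hN, Fintype.card_eq_nat_card, Nat.card_coe_set_eq])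
  have hle : Submodule.span K (Set.range (functional A ∘ Sum.inl)) ≤
      LinearMap.ker (Module.Dual.eval K _ ((Subalgebra.toSubmodule A).mkQ f)) := by
    rw [Submodule.span_le]
    rintro _ ⟨α, rfl⟩
    change f.eval (α : K) - f.eval (rep A α) = 0
    rw [hf α α.2, sub_self]
  rw [hspan] at hle
  rw [← Subalgebra.mem_toSubmodule, ← Submodule.Quotient.mk_eq_zero,
    ← Module.forall_dual_apply_eq_zero_iff K]
  exact fun φ => hle (Submodule.mem_top (x := φ))

end SubalgebraSpectrum

open SubalgebraSpectrum in
theorem spectrum_size_le_and_eq_iff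
    {K : Type*} [Field K] [IsAlgClosed K] [CharZero K]
    (A : Subalgebra K (Polynomial K)) (n : ℕ)
    (hfin : FiniteDimensional K (Polynomial K ⧸ Subalgebra.toSubmodule A))
    (hcodim : Module.finrank K (Polynomial K ⧸ Subalgebra.toSubmodule A) = n) :
    (subalgebraSpectrum A).Finite ∧
    (subalgebraSpectrum A).ncard ≤ 2 * n ∧
    ((subalgebraSpectrum A).ncard = 2 * n ↔
      ∃ α β : Fin n → K,
        Function.Injective (fun x : Fin n ⊕ Fin n => Sum.elim α β x) ∧
        ∀ f : Polynomial K, f ∈ A ↔ ∀ i : Fin n, f.eval (α i) = f.eval (β i)) := by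
  have hle := ncard_spectrum_le A
  rw [hcodim] at hle
  refine ⟨finite_spectrum A, hle, fun hcard => ?_, ?_⟩
  · have h1 := ncard_nonRep_add_ncard_critical_le A
    have h2 := ncard_spectrum_le_add A
    have h3 := Set.ncard_image_le (f := rep A) (finite_nonRep A)
    have hN : (nonRep A).ncard = n := by omega
    have hinj : Set.InjOn (rep A) (nonRep A) :=
      Set.injOn_of_ncard_image_eq (by omega) (finite_nonRep A)
    have := (finite_nonRep A).to_subtype
    let e : Fin n ≃ nonRep A :=
      (Finite.equivFinOfCardEq ((Nat.card_coe_set_eq _).trans hN)).symm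
    refine ⟨fun i => e i, fun i => rep A (e i), ?_, fun f => ⟨fun hf i => ?_, fun hf => ?_⟩⟩
    · refine Function.Injective.sumElim (Subtype.val_injective.comp e.injective)
        (fun i j h => e.injective (Subtype.ext (hinj (e i).2 (e j).2 h))) ?_
      exact fun i j h => rep_notMem_nonRep A (e j) (h ▸ (e i).2)
    · exact (eval_rep A _ hf).symm
    · refine mem_of_forall_eval_eq_eval_rep A (hN.trans hcodim.symm) fun α hα => ?_
      simpa using hf (e.symm ⟨α, hα⟩)
  · rintro ⟨α, β, hinj, hA⟩
    refine le_antisymm hle ?_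
    have hsub : Set.range (Sum.elim α β) ⊆ subalgebraSpectrum A := by
      rintro _ ⟨i | i, rfl⟩
      · exact Or.inr ⟨β i, fun h => Sum.inr_ne_inl (hinj h), fun f hf => (hA f).1 hf i⟩
      · exact Or.inr ⟨α i, fun h => Sum.inl_ne_inr (hinj h), fun f hf => ((hA f).1 hf i).symm⟩
    have h := Set.ncard_le_ncard hsub (finite_spectrum A)
    rw [← Nat.card_coe_set_eq, Nat.card_range_of_injective hinj] at h
    simpa [two_mul] using h
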